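/- Suppose F is a filter base on a topological space X that is stable under countable intersections, K ⊆ X is compact, and the family F ∨ G_δ(K) = {F₀ ∩ F₁ : F₀, F₁ ∈ F ∪ G_δ(K)} is a filter base (i.e., ∅ is not a member). Then F ∨ G_δ(K) is a total filter base that is stable under countable intersections. -/

import Mathlib

open Set Topology

/-- A filter base on `X`: a nonempty family of subsets of `X`, not containing `∅`,
closed under pairwise intersections. -/
def FilterBaseOn (X : Type*) (F : Set (Set X)) : Prop :=
  F.Nonempty ∧ ∅ ∉ F ∧ ∀ A ∈ F, ∀ B ∈ F, A ∩ B ∈ F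

/-- `F` converges to the set `W`: every open set containing `W` contains a member of `F`. -/
def ConvergesTo {X : Type*} [TopologicalSpace X] (F : Set (Set X)) (W : Set X) : Prop :=
  ∀ U : Set X, IsOpen U → W ⊆ U → ∃ A ∈ F, A ⊆ U

/-- `F` is total: every filter base extending `F` has nonempty adherence
(intersection of the closures of all its members). -/
def TotalFB {X : Type*} [TopologicalSpace X] (F : Set (Set X)) : Prop :=
  ∀ H : Set (Set X), FilterBaseOn X H → F ⊆ H → (⋂ A ∈ H, closure A).Nonempty

/-- `F` is stable under countable intersections: every countable subfamily of `F`
has a member of `F` contained in its intersection. -/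
def StableCI {X : Type*} (F : Set (Set X)) : Prop :=
  ∀ S ⊆ F, S.Countable → ∃ H ∈ F, H ⊆ ⋂₀ S

/-- `F` is ω-closed: the intersection of any nonempty countable subfamily of `F` belongs to `F`. -/
def OmegaClosedFB {X : Type*} (F : Set (Set X)) : Prop :=
  ∀ S ⊆ F, S.Countable → S.Nonempty → ⋂₀ S ∈ F

/-- `F` is δ-stable: every nonempty countable subfamily of `F` has nonempty intersection. -/
def DeltaStableFB {X : Type*} (F : Set (Set X)) : Prop :=
  ∀ S ⊆ F, S.Countable → S.Nonempty → (⋂₀ S).Nonempty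

/-- `G_δ(K)`: the family of Gδ subsets (countable intersections of open sets) containing `K`. -/
def GdeltaNbhds {X : Type*} [TopologicalSpace X] (K : Set X) : Set (Set X) :=
  {G | K ⊆ G ∧ IsGδ G}

/-- `F ∨ G = {F₀ ∩ F₁ : F₀, F₁ ∈ F ∪ G}`. -/
def joinFB {X : Type*} (F G : Set (Set X)) : Set (Set X) :=
  {A | ∃ F₀ ∈ F ∪ G, ∃ F₁ ∈ F ∪ G, A = F₀ ∩ F₁}

/-- `X` is totally Lindelöf: every filter base stable under countable intersections
extends to a total filter base stable under countable intersections. -/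
def TotallyLindelofSpace (X : Type*) [TopologicalSpace X] : Prop :=
  ∀ F : Set (Set X), FilterBaseOn X F → StableCI F →
    ∃ H : Set (Set X), FilterBaseOn X H ∧ StableCI H ∧ F ⊆ H ∧ TotalFB H

/-- `X` is Alster: every cover of `X` by Gδ sets such that every compact subset of `X`
is contained in a single member admits a countable subcover. -/
def AlsterSpace (X : Type*) [TopologicalSpace X] : Prop :=
  ∀ 𝒢 : Set (Set X), (∀ G ∈ 𝒢, IsGδ G) → (∀ K : Set X, IsCompact K → ∃ G ∈ 𝒢, K ⊆ G) →
    ∃ 𝒞 ⊆ 𝒢, 𝒞.Countable ∧ ⋃₀ 𝒞 = Set.univ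

/-- `D` is a discrete subset: each of its points has an open neighborhood meeting `D`
only in that point. -/
def IsDiscreteSubset {X : Type*} [TopologicalSpace X] (D : Set X) : Prop :=
  ∀ a ∈ D, ∃ U : Set X, IsOpen U ∧ U ∩ D = {a}

/-- The first uncountable ordinal ω₁. -/
noncomputable def omega1 : Ordinal := (Cardinal.aleph 1).ord

theorem stmt1 {X : Type*} [TopologicalSpace X] (F : Set (Set X)) (K : Set X)
    (hF : FilterBaseOn X F) (hS : StableCI F) (hK : IsCompact K)
    (hfb : FilterBaseOn X (joinFB F (GdeltaNbhds K))) :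
    TotalFB (joinFB F (GdeltaNbhds K)) ∧ StableCI (joinFB F (GdeltaNbhds K)) := by
  constructor
  · intro H hH hsub
    by_contra hne
    rw [not_nonempty_iff_eq_empty] at hne
    obtain ⟨⟨A0, hA0⟩, -, hcl⟩ := And.intro hH.1 hH.2
    have : Nonempty H := ⟨⟨A0, hA0⟩⟩
    obtain ⟨⟨A, hA⟩, hAK⟩ := hK.elim_directed_family_closed
      (fun A : H => closure (A : Set X)) (fun _ => isClosed_closure)
      (by
        rw [biInter_eq_iInter] at hne
        rw [hne, inter_empty])
      (by
        rintro ⟨A, hA⟩ ⟨B, hB⟩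
        exact ⟨⟨A ∩ B, hcl A hA B hB⟩, closure_mono inter_subset_left,
          closure_mono inter_subset_right⟩)
    have hU : (closure A)ᶜ ∈ GdeltaNbhds K := by
      refine ⟨fun x hx hxA => ?_, isClosed_closure.isOpen_compl.isGδ⟩
      have : x ∈ K ∩ closure A := ⟨hx, hxA⟩
      simp only at hAK
      rw [hAK] at this
      exact this
    have hUH : (closure A)ᶜ ∈ H :=
      hsub ⟨_, Or.inr hU, _, Or.inr hU, (inter_self _).symm⟩
    have h0 := hcl A hA _ hUH
    have he : A ∩ (closure A)ᶜ = ∅ := by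
      ext x
      simp only [mem_inter_iff, mem_compl_iff, mem_empty_iff_false, iff_false, not_and, not_not]
      exact fun h => subset_closure h
    rw [he] at h0
    exact hH.2.1 h0
  · intro S hSsub hSc
    choose! f hf g hg hfg using hSsub
    have hC : (f '' S ∪ g '' S).Countable := (hSc.image f).union (hSc.image g)
    obtain ⟨B, hB, hBs⟩ := hS ((f '' S ∪ g '' S) ∩ F) inter_subset_right
      (hC.mono inter_subset_left)
    have hG : ⋂₀ ((f '' S ∪ g '' S) ∩ GdeltaNbhds K) ∈ GdeltaNbhds K :=
      ⟨subset_sInter fun t ht => ht.2.1,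
        IsGδ.sInter (fun t ht => ht.2.2) (hC.mono inter_subset_left)⟩
    refine ⟨_, ⟨B, Or.inl hB, _, Or.inr hG, rfl⟩, ?_⟩
    rintro x ⟨hxB, hxG⟩
    have key : ∀ t ∈ f '' S ∪ g '' S, t ∈ F ∪ GdeltaNbhds K → x ∈ t := by
      rintro t ht (h | h)
      · exact hBs hxB t ⟨ht, h⟩
      · exact hxG t ⟨ht, h⟩
    intro A hA
    rw [hfg hA]
    exact ⟨key _ (Or.inl ⟨A, hA, rfl⟩) (hf hA), key _ (Or.inr ⟨A, hA, rfl⟩) (hg hA)⟩
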